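/- Let N ≥ 3 be an integer, let a, b > −2 and p, q > 0 with pq > 1, let Ω ⊆ ℝ^N be a domain containing the origin, and let (u, v) be a positive solution of the Hardy–Hénon system on Ω. Then (u, v) is a distributional solution of the system on all of Ω: for every smooth compactly supported function φ : ℝ^N → ℝ with support contained in Ω, one has ∫_Ω ( u(x) Δφ(x) + |x|^a v(x)^p φ(x) ) dx = 0 and ∫_Ω ( v(x) Δφ(x) + |x|^b u(x)^q φ(x) ) dx = 0. -/

import Mathlib

open MeasureTheory Metric Set Filter

/-- The Euclidean Laplacian of `u : ℝ^N → ℝ`, as the sum of the second derivatives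
along the standard coordinate directions. -/
noncomputable def lap {N : ℕ} (u : EuclideanSpace ℝ (Fin N) → ℝ)
    (x : EuclideanSpace ℝ (Fin N)) : ℝ :=
  ∑ i : Fin N, iteratedFDeriv ℝ 2 u x ![EuclideanSpace.single i 1, EuclideanSpace.single i 1]

/-- `(u, v)` is a positive solution of the Hardy–Hénon system
`-Δu = |x|^a v^p`, `-Δv = |x|^b u^q` on the set `Ω`:
`u, v` are continuous on `Ω`, `C²` on `Ω \ {0}`, positive on `Ω`, and
the equations hold on `Ω \ {0}`. -/
def IsHHSol {N : ℕ} (a b p q : ℝ) (Ω : Set (EuclideanSpace ℝ (Fin N)))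
    (u v : EuclideanSpace ℝ (Fin N) → ℝ) : Prop :=
  ContinuousOn u Ω ∧ ContinuousOn v Ω ∧
  ContDiffOn ℝ 2 u (Ω \ {0}) ∧ ContDiffOn ℝ 2 v (Ω \ {0}) ∧
  (∀ x ∈ Ω, 0 < u x) ∧ (∀ x ∈ Ω, 0 < v x) ∧
  (∀ x ∈ Ω \ {0}, -lap u x = ‖x‖ ^ a * v x ^ p) ∧
  (∀ x ∈ Ω \ {0}, -lap v x = ‖x‖ ^ b * u x ^ q)

section Laplacian

variable {N : ℕ}

theorem fderiv_fderiv_apply_const {E : Type*} [NormedAddCommGroup E] [NormedSpace ℝ E]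
    {f : E → ℝ} {x : E} (hf : ContDiffAt ℝ 2 f x) (e : E) :
    fderiv ℝ (fun y => fderiv ℝ f y e) x e = iteratedFDeriv ℝ 2 f x ![e, e] := by
  have hd : DifferentiableAt ℝ (fderiv ℝ f) x :=
    (hf.fderiv_right (m := 1) (by norm_num)).differentiableAt (by norm_num)
  rw [iteratedFDeriv_two_apply, fderiv_clm_apply hd (differentiableAt_const e)]
  simp

theorem lap_eq_sum_fderiv {f : EuclideanSpace ℝ (Fin N) → ℝ} {x : EuclideanSpace ℝ (Fin N)}
    (hf : ContDiffAt ℝ 2 f x) :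
    lap f x = ∑ i : Fin N, fderiv ℝ (fun y => fderiv ℝ f y (EuclideanSpace.single i 1)) x
      (EuclideanSpace.single i 1) := by
  simp only [lap, fderiv_fderiv_apply_const hf]

theorem lap_eq_laplacian (f : EuclideanSpace ℝ (Fin N) → ℝ) :
    lap f = Laplacian.laplacian f := by
  ext x
  rw [InnerProductSpace.laplacian_eq_iteratedFDeriv_orthonormalBasis f
    (EuclideanSpace.basisFun (Fin N) ℝ)]
  simp [lap]

theorem lap_eq_zero_of_notMem_tsupport {f : EuclideanSpace ℝ (Fin N) → ℝ}
    {x : EuclideanSpace ℝ (Fin N)} (hx : x ∉ tsupport f) : lap f x = 0 := by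
  have : iteratedFDeriv ℝ 2 f x = 0 := by
    by_contra h
    exact hx (support_iteratedFDeriv_subset 2 h)
  simp [lap, this]

theorem continuous_lap {f : EuclideanSpace ℝ (Fin N) → ℝ} (hf : ContDiff ℝ 2 f) :
    Continuous (lap f) := by
  have h := hf.continuous_iteratedFDeriv (m := 2) le_rfl
  unfold lap
  fun_prop

end Laplacian

section Green

theorem ContinuousOn.integrable_mul_of_tsupport_subset {E : Type*} [TopologicalSpace E]
    [MeasurableSpace E] [OpensMeasurableSpace E] {μ : Measure E} [IsFiniteMeasureOnCompacts μ]
    {U : Set E} (hU : IsOpen U) {f g : E → ℝ} (hf : ContinuousOn f U) (hg : Continuous g)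
    (hgc : HasCompactSupport g) (hgU : tsupport g ⊆ U) :
    Integrable (fun x => f x * g x) μ := by
  have hsub : tsupport (fun x => f x * g x) ⊆ tsupport g := tsupport_mul_subset_right
  refine Continuous.integrable_of_hasCompactSupport ?_ hgc.mul_left
  refine continuous_of_tsupport fun x hx => ?_
  exact (hf.continuousAt (hU.mem_nhds (hgU (hsub hx)))).mul hg.continuousAt

variable {N : ℕ}

theorem integral_mul_lap_eq_integral_lap_mul {U : Set (EuclideanSpace ℝ (Fin N))}
    (hU : IsOpen U) {u ψ : EuclideanSpace ℝ (Fin N) → ℝ} (hu : ContDiffOn ℝ 2 u U)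
    (hψ : ContDiff ℝ 2 ψ) (hψc : HasCompactSupport ψ) (hψU : tsupport ψ ⊆ U) :
    ∫ x, u x * lap ψ x = ∫ x, lap u x * ψ x := by
  have hu_at : ∀ x ∈ U, ContDiffAt ℝ 2 u x := fun x hx => hu.contDiffAt (hU.mem_nhds hx)
  have hdu : ContDiffOn ℝ 1 (fderiv ℝ u) U := hu.fderiv_of_isOpen hU (by norm_num)
  have hdψ : ContDiff ℝ 1 (fderiv ℝ ψ) := hψ.fderiv_right (by norm_num)
  set e : Fin N → EuclideanSpace ℝ (Fin N) := fun i => EuclideanSpace.single i 1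
  have hdui (i) : ContDiffOn ℝ 1 (fun y => fderiv ℝ u y (e i)) U :=
    hdu.clm_apply contDiffOn_const
  have hdψi (i) : ContDiff ℝ 1 (fun y => fderiv ℝ ψ y (e i)) := hdψ.clm_apply contDiff_const
  have hddui (i) : ContinuousOn (fun x => fderiv ℝ (fun y => fderiv ℝ u y (e i)) x (e i)) U :=
    ((hdui i).continuousOn_fderiv_of_isOpen hU le_rfl).clm_apply continuousOn_const
  have hddψi (i) : Continuous (fun x => fderiv ℝ (fun y => fderiv ℝ ψ y (e i)) x (e i)) :=
    ((hdψi i).continuous_fderiv one_ne_zero).clm_apply continuous_const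
  have hsub1 (i) : tsupport (fun y => fderiv ℝ ψ y (e i)) ⊆ tsupport ψ :=
    tsupport_fderiv_apply_subset ℝ (e i)
  have hsub2 (i) : tsupport (fun x => fderiv ℝ (fun y => fderiv ℝ ψ y (e i)) x (e i)) ⊆
      tsupport ψ := (tsupport_fderiv_apply_subset ℝ (e i)).trans (hsub1 i)
  have hc1 (i) : HasCompactSupport (fun y => fderiv ℝ ψ y (e i)) :=
    hψc.mono' (subset_closure.trans (hsub1 i))
  have hc2 (i) : HasCompactSupport (fun x => fderiv ℝ (fun y => fderiv ℝ ψ y (e i)) x (e i)) :=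
    hψc.mono' (subset_closure.trans (hsub2 i))
  have hint0 (i) : Integrable fun x => u x * fderiv ℝ (fun y => fderiv ℝ ψ y (e i)) x (e i) :=
    hu.continuousOn.integrable_mul_of_tsupport_subset hU (hddψi i) (hc2 i)
      ((hsub2 i).trans hψU)
  have hint1 (i) : Integrable fun x => fderiv ℝ u x (e i) * fderiv ℝ ψ x (e i) :=
    (hdui i).continuousOn.integrable_mul_of_tsupport_subset hU (hdψi i).continuous (hc1 i)
      ((hsub1 i).trans hψU)
  have hint2 (i) : Integrable fun x => fderiv ℝ (fun y => fderiv ℝ u y (e i)) x (e i) * ψ x :=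
    (hddui i).integrable_mul_of_tsupport_subset hU hψ.continuous hψc hψU
  have hparts1 (i) : ∫ x, u x * fderiv ℝ (fun y => fderiv ℝ ψ y (e i)) x (e i) =
      - ∫ x, fderiv ℝ u x (e i) * fderiv ℝ ψ x (e i) :=
    integral_mul_fderiv_eq_neg_fderiv_mul_of_integrable (hint1 i) (hint0 i)
      (hu.continuousOn.integrable_mul_of_tsupport_subset hU (hdψi i).continuous (hc1 i)
        ((hsub1 i).trans hψU))
      (fun x hx => (hu_at x (hψU (hsub1 i hx))).differentiableAt (by norm_num))
      (fun x _ => (hdψi i).contDiffAt.differentiableAt (by norm_num))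
  have hparts2 (i) : ∫ x, fderiv ℝ u x (e i) * fderiv ℝ ψ x (e i) =
      - ∫ x, fderiv ℝ (fun y => fderiv ℝ u y (e i)) x (e i) * ψ x :=
    integral_mul_fderiv_eq_neg_fderiv_mul_of_integrable (hint2 i) (hint1 i)
      ((hdui i).continuousOn.integrable_mul_of_tsupport_subset hU hψ.continuous hψc hψU)
      (fun x hx => ((hdui i).contDiffAt (hU.mem_nhds (hψU hx))).differentiableAt (by norm_num))
      (fun x _ => hψ.contDiffAt.differentiableAt (by norm_num))
  have hlapψ : (fun x => u x * lap ψ x) =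
      fun x => ∑ i, u x * fderiv ℝ (fun y => fderiv ℝ ψ y (e i)) x (e i) := by
    ext x
    rw [lap_eq_sum_fderiv hψ.contDiffAt, Finset.mul_sum]
  have hlapu : (fun x => lap u x * ψ x) =
      fun x => ∑ i, fderiv ℝ (fun y => fderiv ℝ u y (e i)) x (e i) * ψ x := by
    ext x
    by_cases hx : x ∈ tsupport ψ
    · rw [lap_eq_sum_fderiv (hu_at x (hψU hx)), Finset.sum_mul]
    · simp [image_eq_zero_of_notMem_tsupport hx]
  rw [hlapψ, hlapu, integral_finsetSum _ fun i _ => hint0 i, integral_finsetSum _ fun i _ => hint2 i]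
  exact Finset.sum_congr rfl fun i _ => by rw [hparts1, hparts2, neg_neg]

end Green

section Cutoff

variable {N : ℕ}

theorem exists_bound_fderiv_of_hasCompactSupport {E : Type*} [NormedAddCommGroup E]
    [NormedSpace ℝ E] {f : E → ℝ} (hf : ContDiff ℝ 2 f) (hfc : HasCompactSupport f) (e : E) :
    ∃ C, 0 ≤ C ∧ ∀ x, |f x| ≤ C ∧ |fderiv ℝ f x e| ≤ C ∧
      |fderiv ℝ (fun y => fderiv ℝ f y e) x e| ≤ C := by
  have h1 : ContDiff ℝ 1 (fun y => fderiv ℝ f y e) :=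
    (hf.fderiv_right (m := 1) (by norm_num)).clm_apply contDiff_const
  have h2 : Continuous (fun x => fderiv ℝ (fun y => fderiv ℝ f y e) x e) :=
    (h1.continuous_fderiv one_ne_zero).clm_apply continuous_const
  have hc1 : HasCompactSupport (fun y => fderiv ℝ f y e) := hfc.fderiv_apply ℝ e
  obtain ⟨A, hA⟩ := hfc.exists_bound_of_continuous hf.continuous
  obtain ⟨B, hB⟩ := hc1.exists_bound_of_continuous h1.continuous
  obtain ⟨C, hC⟩ := (hc1.fderiv_apply ℝ e).exists_bound_of_continuous h2
  simp only [Real.norm_eq_abs] at hA hB hC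
  refine ⟨max A (max B C), ((abs_nonneg _).trans (hA 0)).trans (le_max_left _ _), fun x =>
    ⟨(hA x).trans (le_max_left _ _), (hB x).trans ?_, (hC x).trans ?_⟩⟩ <;> simp

theorem fderiv_fderiv_mul_comp_smul {E : Type*} [NormedAddCommGroup E] [NormedSpace ℝ E]
    {φ χ : E → ℝ} (hφ : ContDiff ℝ 2 φ) (hχ : ContDiff ℝ 2 χ) (t : ℝ) (e x : E) :
    fderiv ℝ (fun y => fderiv ℝ (fun z => φ z * χ (t • z)) y e) x e =
      φ x * (t ^ 2 * fderiv ℝ (fun y => fderiv ℝ χ y e) (t • x) e) +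
        2 * (t * fderiv ℝ χ (t • x) e * fderiv ℝ φ x e) +
        χ (t • x) * fderiv ℝ (fun y => fderiv ℝ φ y e) x e := by
  have hφ1 : Differentiable ℝ φ := hφ.differentiable (by norm_num)
  have hχ1 : Differentiable ℝ χ := hχ.differentiable (by norm_num)
  have hdφ : Differentiable ℝ (fun y => fderiv ℝ φ y e) :=
    ((hφ.fderiv_right (m := 1) (by norm_num)).clm_apply contDiff_const).differentiable
      (by norm_num)
  have hdχ : Differentiable ℝ (fun y => fderiv ℝ χ y e) :=
    ((hχ.fderiv_right (m := 1) (by norm_num)).clm_apply contDiff_const).differentiable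
      (by norm_num)
  have hχt : Differentiable ℝ (fun y => χ (t • y)) := hχ1.comp (by fun_prop)
  have hdχt : Differentiable ℝ (fun y => t * fderiv ℝ χ (t • y) e) :=
    (hdχ.comp (g := fun y => fderiv ℝ χ y e) (f := fun y => t • y) (by fun_prop)).const_mul t
  have hscale (f : E → ℝ) (y : E) :
      fderiv ℝ (fun z => f (t • z)) y e = t * fderiv ℝ f (t • y) e := by
    have h := fderiv_comp_smul (𝕜 := ℝ) (f := f) (x := y) t
    rw [h]; simp
  have hfirst : (fun y => fderiv ℝ (fun z => φ z * χ (t • z)) y e) =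
      fun y => φ y * (t * fderiv ℝ χ (t • y) e) + χ (t • y) * fderiv ℝ φ y e := by
    ext y
    rw [fderiv_fun_mul (hφ1 y) (hχt y)]
    simp [hscale]
  have hsecond : fderiv ℝ (fun y => t * fderiv ℝ χ (t • y) e) x e =
      t ^ 2 * fderiv ℝ (fun y => fderiv ℝ χ y e) (t • x) e := by
    have h := fderiv_const_mul (𝕜 := ℝ)
      ((hdχ.comp (g := fun y => fderiv ℝ χ y e) (f := fun y => t • y) (by fun_prop)) x) t
    simp only [Function.comp_def] at h
    rw [h]
    simp [hscale (fun y => fderiv ℝ χ y e)]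
    ring
  rw [hfirst, fderiv_fun_add ((hφ1 x).fun_mul (hdχt x)) ((hχt x).fun_mul (hdφ x)),
    fderiv_fun_mul (hφ1 x) (hdχt x), fderiv_fun_mul (hχt x) (hdφ x)]
  simp only [_root_.add_apply, _root_.smul_apply, smul_eq_mul,
    hsecond, hscale]
  ring

theorem exists_bound_lap_mul_comp_smul {φ χ : EuclideanSpace ℝ (Fin N) → ℝ}
    (hφ : ContDiff ℝ 2 φ) (hφc : HasCompactSupport φ)
    (hχ : ContDiff ℝ 2 χ) (hχc : HasCompactSupport χ) :
    ∃ K, 0 ≤ K ∧ ∀ t : ℝ, 1 ≤ t → ∀ x, |lap (fun y => φ y * χ (t • y)) x| ≤ K * t ^ 2 := by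
  choose A hA0 hA using fun i : Fin N =>
    exists_bound_fderiv_of_hasCompactSupport hφ hφc (EuclideanSpace.single i 1)
  choose B hB0 hB using fun i : Fin N =>
    exists_bound_fderiv_of_hasCompactSupport hχ hχc (EuclideanSpace.single i 1)
  refine ⟨∑ i, 4 * (A i * B i), Finset.sum_nonneg fun i _ => by
    have := hA0 i; have := hB0 i; positivity, fun t ht x => ?_⟩
  have hsmooth : ContDiff ℝ 2 (fun y => φ y * χ (t • y)) :=
    hφ.mul (hχ.comp (contDiff_const_smul t))
  rw [lap_eq_sum_fderiv hsmooth.contDiffAt, Finset.sum_mul]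
  refine (Finset.abs_sum_le_sum_abs _ _).trans (Finset.sum_le_sum fun i _ => ?_)
  rw [fderiv_fderiv_mul_comp_smul hφ hχ]
  obtain ⟨a0, a1, a2⟩ := hA i x
  obtain ⟨b0, b1, b2⟩ := hB i (t • x)
  have hA0 := hA0 i
  have hB0 := hB0 i
  have ht0 : 0 ≤ t := zero_le_one.trans ht
  have ht2 : t ≤ t ^ 2 := by nlinarith
  have ht1 : 1 ≤ t ^ 2 := by nlinarith
  have hAB : 0 ≤ A i * B i := mul_nonneg hA0 hB0
  refine (abs_add_three _ _ _).trans ?_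
  simp only [abs_mul, abs_pow, abs_of_nonneg ht0, abs_two]
  calc _ ≤ A i * (t ^ 2 * B i) + 2 * (t * B i * A i) + B i * A i := by gcongr
    _ ≤ 4 * (A i * B i) * t ^ 2 := by nlinarith

end Cutoff

section RemovableSingularity

variable {N : ℕ}

open scoped Topology

theorem tendsto_integral_mul_lap_mul_cutoff (hN : 3 ≤ N)
    {Ω : Set (EuclideanSpace ℝ (Fin N))} (hΩ : IsOpen Ω)
    (h0 : (0 : EuclideanSpace ℝ (Fin N)) ∈ Ω)
    {u φ χ : EuclideanSpace ℝ (Fin N) → ℝ} (hu : ContinuousOn u Ω)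
    (hφ : ContDiff ℝ 2 φ) (hφc : HasCompactSupport φ)
    (hχ : ContDiff ℝ 2 χ) (hχc : HasCompactSupport χ)
    (hχs : tsupport χ ⊆ closedBall 0 2) :
    Tendsto (fun ε : ℝ => ∫ x, u x * lap (fun y => φ y * χ (ε⁻¹ • y)) x) (𝓝[>] 0) (𝓝 0) := by
  obtain ⟨K, hK0, hK⟩ := exists_bound_lap_mul_comp_smul hφ hφc hχ hχc
  obtain ⟨R, hR0, hR⟩ := nhds_basis_closedBall.mem_iff.mp (hΩ.mem_nhds h0)
  obtain ⟨M, hM⟩ := (isCompact_closedBall (0 : EuclideanSpace ℝ (Fin N))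
    R).exists_bound_of_continuousOn (hu.mono hR)
  have hM0 : 0 ≤ M := (norm_nonneg _).trans (hM 0 (by simp [hR0.le]))
  set V : ℝ := volume.real (ball (0 : EuclideanSpace ℝ (Fin N)) 1)
  have hlim : Tendsto (fun ε : ℝ => M * K * 2 ^ N * V * ε ^ (N - 2)) (𝓝[>] 0) (𝓝 0) := by
    have hc : Continuous fun ε : ℝ => M * K * 2 ^ N * V * ε ^ (N - 2) := by fun_prop
    have := hc.tendsto 0
    rw [zero_pow (by omega), mul_zero] at this
    exact this.mono_left nhdsWithin_le_nhds
  refine squeeze_zero_norm' ?_ hlim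
  have hsmall : ∀ᶠ ε : ℝ in 𝓝[>] 0, ε < min 1 (R / 2) :=
    nhdsWithin_le_nhds (Iio_mem_nhds (by positivity))
  filter_upwards [hsmall, self_mem_nhdsWithin] with ε hε hε0
  have hε0 : 0 < ε := hε0
  have hε1 : ε ≤ 1 := hε.le.trans (min_le_left _ _)
  have hεR : 2 * ε ≤ R := by linarith [hε.le.trans (min_le_right _ _)]
  have hzero : ∀ x, x ∉ closedBall (0 : EuclideanSpace ℝ (Fin N)) (2 * ε) →
      lap (fun y => φ y * χ (ε⁻¹ • y)) x = 0 := by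
    intro x hx
    refine lap_eq_zero_of_notMem_tsupport fun h => hx ?_
    have h1 : x ∈ tsupport (fun y => χ (ε⁻¹ • y)) := tsupport_mul_subset_right h
    have h2 : ε⁻¹ • x ∈ closedBall (0 : EuclideanSpace ℝ (Fin N)) 2 :=
      hχs (tsupport_comp_subset_preimage χ (f := fun y => ε⁻¹ • y) (by fun_prop) h1)
    rw [mem_closedBall_zero_iff, norm_smul, norm_inv, Real.norm_of_nonneg hε0.le,
      inv_mul_le_iff₀ hε0] at h2
    rw [mem_closedBall_zero_iff]
    linarith
  rw [← setIntegral_eq_integral_of_forall_compl_eq_zero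
    (s := closedBall (0 : EuclideanSpace ℝ (Fin N)) (2 * ε))
    fun x hx => by rw [hzero x hx, mul_zero]]
  have hbound := norm_setIntegral_le_of_norm_le_const
    (μ := volume) (s := closedBall (0 : EuclideanSpace ℝ (Fin N)) (2 * ε))
    (f := fun x => u x * lap (fun y => φ y * χ (ε⁻¹ • y)) x) (C := M * (K * ε⁻¹ ^ 2))
    measure_closedBall_lt_top (fun x hx => by
      rw [norm_mul]
      exact mul_le_mul (hM x (closedBall_subset_closedBall hεR hx))
        (hK _ ((one_le_inv₀ hε0).2 hε1) x) (norm_nonneg _) hM0)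
  refine hbound.trans (le_of_eq ?_)
  rw [Measure.addHaar_real_closedBall _ _ (by positivity), finrank_euclideanSpace_fin]
  obtain ⟨n, rfl⟩ : ∃ n, N = n + 2 := ⟨N - 2, by omega⟩
  simp only [Nat.add_sub_cancel]
  field_simp
  ring

theorem locallyIntegrable_norm_rpow (hN : 1 ≤ N) {a : ℝ} (ha : -(N : ℝ) < a) :
    LocallyIntegrable (fun x : EuclideanSpace ℝ (Fin N) => ‖x‖ ^ a) := by
  refine locallyIntegrable_of_norm_le_rpow (C := 1) (α := -a) ?_ ?_
    (ae_of_all _ fun x => ?_) (measurable_norm.pow_const a).aestronglyMeasurable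
  · rwa [finrank_euclideanSpace_fin]
  · rw [finrank_euclideanSpace_fin]
    linarith
  · rw [neg_neg, one_mul, Real.norm_of_nonneg (by positivity)]

theorem integral_mul_lap_add_eq_zero (hN : 3 ≤ N) {a : ℝ} (ha : -2 < a)
    {Ω : Set (EuclideanSpace ℝ (Fin N))} (hΩ : IsOpen Ω)
    (h0 : (0 : EuclideanSpace ℝ (Fin N)) ∈ Ω)
    {u w φ : EuclideanSpace ℝ (Fin N) → ℝ} (hu : ContinuousOn u Ω)
    (hu2 : ContDiffOn ℝ 2 u (Ω \ {0})) (hw : ContinuousOn w Ω)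
    (heq : ∀ x ∈ Ω \ {0}, -lap u x = ‖x‖ ^ a * w x)
    (hφ : ContDiff ℝ 2 φ) (hφc : HasCompactSupport φ) (hφΩ : tsupport φ ⊆ Ω) :
    ∫ x in Ω, (u x * lap φ x + ‖x‖ ^ a * w x * φ x) = 0 := by
  let χ : ContDiffBump (0 : EuclideanSpace ℝ (Fin N)) := ⟨1, 2, one_pos, one_lt_two⟩
  have hχ : ContDiff ℝ 2 χ := χ.contDiff
  have hχt (t : ℝ) : ContDiff ℝ 2 fun y => χ (t • y) := hχ.comp (contDiff_const_smul t)
  have hχs : tsupport χ ⊆ closedBall 0 2 := χ.tsupport_eq.subset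
  rw [setIntegral_eq_integral_of_forall_compl_eq_zero fun x hx => by
    have hx' : x ∉ tsupport φ := fun h => hx (hφΩ h)
    simp [lap_eq_zero_of_notMem_tsupport hx', image_eq_zero_of_notMem_tsupport hx']]
  have hU : IsOpen (Ω \ {0}) := hΩ.sdiff isClosed_singleton
  have hlapint {ψ : EuclideanSpace ℝ (Fin N) → ℝ} (hψ : ContDiff ℝ 2 ψ)
      (hψs : tsupport ψ ⊆ tsupport φ) : Integrable fun x => u x * lap ψ x := by
    have hs : tsupport (lap ψ) ⊆ tsupport φ := by
      refine (closure_minimal (fun x hx => ?_) (isClosed_tsupport ψ)).trans hψs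
      by_contra h
      exact hx (lap_eq_zero_of_notMem_tsupport h)
    exact hu.integrable_mul_of_tsupport_subset hΩ (continuous_lap hψ)
      (hφc.mono' (subset_closure.trans hs)) (hs.trans hφΩ)
  have hwφ : Continuous fun x => w x * φ x := by
    refine continuous_of_tsupport fun x hx => ?_
    exact (hw.continuousAt (hΩ.mem_nhds (hφΩ (tsupport_mul_subset_right hx)))).mul
      hφ.continuous.continuousAt
  have hloc : LocallyIntegrable (fun x : EuclideanSpace ℝ (Fin N) => ‖x‖ ^ a) := by
    refine locallyIntegrable_norm_rpow (by omega) ?_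
    have : (3 : ℝ) ≤ N := by exact_mod_cast hN
    linarith
  have hsrc : Integrable fun x => ‖x‖ ^ a * w x * φ x := by
    have := hloc.integrable_smul_left_of_hasCompactSupport hwφ hφc.mul_left
    refine this.congr (ae_of_all _ fun x => ?_)
    simp only [smul_eq_mul]
    ring
  have hsrcχ (t : ℝ) : Integrable fun x => ‖x‖ ^ a * w x * φ x * χ (t • x) := by
    refine hsrc.mul_bdd (c := 1) (hχt t).continuous.aestronglyMeasurable
      (ae_of_all _ fun x => ?_)
    rw [Real.norm_of_nonneg χ.nonneg]
    exact χ.le_one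
  have hconst (ε : ℝ) (hε : 0 < ε) :
      ∫ x, (u x * lap φ x + ‖x‖ ^ a * w x * φ x) =
        (∫ x, u x * lap (fun y => φ y * χ (ε⁻¹ • y)) x) +
          ∫ x, ‖x‖ ^ a * w x * φ x * χ (ε⁻¹ • x) := by
    set ζ : EuclideanSpace ℝ (Fin N) → ℝ := fun y => φ y * χ (ε⁻¹ • y) with hζ
    have hζ2 : ContDiff ℝ 2 ζ := hφ.mul (hχt _)
    have hψ2 : ContDiff ℝ 2 (φ - ζ) := hφ.sub hζ2
    have hψφ : tsupport (φ - ζ) ⊆ tsupport φ := by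
      have : φ - ζ = fun y => φ y * (1 - χ (ε⁻¹ • y)) := by
        ext y
        simp only [hζ, Pi.sub_apply]
        ring
      rw [this]
      exact tsupport_mul_subset_left
    have hψ0 : (0 : EuclideanSpace ℝ (Fin N)) ∉ tsupport (φ - ζ) := by
      rw [notMem_tsupport_iff_eventuallyEq]
      filter_upwards [closedBall_mem_nhds (0 : EuclideanSpace ℝ (Fin N)) hε] with x hx
      have h1 : χ (ε⁻¹ • x) = 1 := by
        refine χ.one_of_mem_closedBall ?_
        rw [mem_closedBall_zero_iff] at hx ⊢
        rw [norm_smul, norm_inv, Real.norm_of_nonneg hε.le, inv_mul_le_iff₀ hε]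
        simpa [χ] using hx
      simp [hζ, h1]
    have hψU : tsupport (φ - ζ) ⊆ Ω \ {0} := fun x hx =>
      ⟨hφΩ (hψφ hx), fun h => hψ0 (mem_singleton_iff.mp h ▸ hx)⟩
    have hgreen := integral_mul_lap_eq_integral_lap_mul hU hu2 hψ2
      (hφc.mono' (subset_closure.trans hψφ)) hψU
    have hleft : ∫ x, u x * lap (φ - ζ) x = (∫ x, u x * lap φ x) - ∫ x, u x * lap ζ x := by
      rw [← integral_sub (hlapint hφ subset_rfl) (hlapint hζ2 tsupport_mul_subset_left)]
      refine integral_congr_ae (ae_of_all _ fun x => ?_)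
      simp only [lap_eq_laplacian, hφ.contDiffAt.laplacian_sub hζ2.contDiffAt]
      ring
    have hright : ∫ x, lap u x * (φ - ζ) x = (∫ x, ‖x‖ ^ a * w x * φ x * χ (ε⁻¹ • x)) -
        ∫ x, ‖x‖ ^ a * w x * φ x := by
      rw [← integral_sub (hsrcχ _) hsrc]
      refine integral_congr_ae (ae_of_all _ fun x => ?_)
      by_cases hx : x ∈ tsupport (φ - ζ)
      · have := heq x (hψU hx)
        simp only [hζ, Pi.sub_apply]
        linear_combination (φ x * χ (ε⁻¹ • x) - φ x) * this
      · have := image_eq_zero_of_notMem_tsupport hx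
        simp only [this, mul_zero]
        simp only [hζ, Pi.sub_apply] at this
        linear_combination ‖x‖ ^ a * w x * this
    rw [integral_add (hlapint hφ subset_rfl) hsrc]
    linarith
  have hlim2 : Tendsto (fun ε : ℝ => ∫ x, ‖x‖ ^ a * w x * φ x * χ (ε⁻¹ • x)) (𝓝[>] 0)
      (𝓝 0) := by
    suffices h : Tendsto (fun ε : ℝ => ∫ x, ‖x‖ ^ a * w x * φ x * χ (ε⁻¹ • x)) (𝓝[>] 0)
        (𝓝 (∫ _ : EuclideanSpace ℝ (Fin N), (0 : ℝ))) by rwa [integral_zero] at h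
    refine tendsto_integral_filter_of_dominated_convergence
      (fun x => ‖‖x‖ ^ a * w x * φ x‖) (Eventually.of_forall fun ε => (hsrcχ _).1)
      (Eventually.of_forall fun ε => ae_of_all _ fun x => ?_) hsrc.norm ?_
    · rw [norm_mul, Real.norm_of_nonneg (χ.nonneg (x := ε⁻¹ • x))]
      exact mul_le_of_le_one_right (norm_nonneg _) χ.le_one
    · have : Nontrivial (EuclideanSpace ℝ (Fin N)) := by
        have : Nonempty (Fin N) := ⟨⟨0, by omega⟩⟩
        infer_instance
      filter_upwards [Measure.ae_ne volume (0 : EuclideanSpace ℝ (Fin N))] with x hx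
      refine tendsto_const_nhds.congr' ?_
      have hsmall : ∀ᶠ ε : ℝ in 𝓝[>] 0, ε < ‖x‖ / 2 :=
        nhdsWithin_le_nhds (Iio_mem_nhds (by positivity))
      filter_upwards [hsmall, self_mem_nhdsWithin] with ε hε hε0
      have hε0 : 0 < ε := hε0
      rw [χ.zero_of_le_dist, mul_zero]
      rw [dist_zero_right, norm_smul, norm_inv, Real.norm_of_nonneg hε0.le,
        le_inv_mul_iff₀ hε0]
      change ε * 2 ≤ ‖x‖
      linarith
  have hlim := (tendsto_integral_mul_lap_mul_cutoff hN hΩ h0 hu hφ hφc hχ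
    χ.hasCompactSupport hχs).add hlim2
  rw [add_zero] at hlim
  refine tendsto_nhds_unique (tendsto_const_nhds.congr' ?_) hlim
  filter_upwards [self_mem_nhdsWithin] with ε hε using hconst ε hε

end RemovableSingularity

/-- Lemma 6.1 (second part): a positive solution of the Hardy–Hénon system on a domain
containing the origin is a distributional solution on all of `Ω`. -/
theorem distributional_solution
    (N : ℕ) (hN : 3 ≤ N) (a b p q : ℝ) (ha : -2 < a) (hb : -2 < b)
    (hp : 0 < p) (hq : 0 < q) (hpq : 1 < p * q)
    (Ω : Set (EuclideanSpace ℝ (Fin N))) (hΩo : IsOpen Ω) (hΩc : IsConnected Ω)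
    (h0 : (0 : EuclideanSpace ℝ (Fin N)) ∈ Ω)
    (u v : EuclideanSpace ℝ (Fin N) → ℝ) (huv : IsHHSol a b p q Ω u v) :
    ∀ φ : EuclideanSpace ℝ (Fin N) → ℝ, ContDiff ℝ (⊤ : ℕ∞) φ → HasCompactSupport φ →
      tsupport φ ⊆ Ω →
      (∫ x in Ω, (u x * lap φ x + ‖x‖ ^ a * v x ^ p * φ x)) = 0 ∧
      (∫ x in Ω, (v x * lap φ x + ‖x‖ ^ b * u x ^ q * φ x)) = 0 := by
  obtain ⟨hu, hv, hu2, hv2, hu0, hv0, heu, hev⟩ := huv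
  intro φ hφ hφc hφΩ
  have hφ2 : ContDiff ℝ 2 φ := hφ.of_le (WithTop.coe_le_coe.2 le_top)
  exact ⟨integral_mul_lap_add_eq_zero hN ha hΩo h0 hu hu2
      (hv.rpow_const fun x hx => Or.inl (hv0 x hx).ne') heu hφ2 hφc hφΩ,
    integral_mul_lap_add_eq_zero hN hb hΩo h0 hv hv2
      (hu.rpow_const fun x hx => Or.inl (hu0 x hx).ne') hev hφ2 hφc hφΩ⟩
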